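/- arXiv:2307.04345 — 2 statements merged into one kernel-verified Lean document; each statement's English description precedes it below -/
import Mathlib

section
/- Suppose Y and U are conditionally independent given H. Then the reduction in informational error relative to an uninformed prediction equals the mutual information between Y and the agent state, which is bounded by the entropy of the agent state: E[d_KL(P*‖P₀)] − E[d_KL(P*‖P̃)] = I(Y; U), and I(Y; U) ≤ H(U). -/
open MeasureTheory

/-- The probability mass function of a random variable `X` under `μ`. -/
noncomputable def pmfOf {Ω α : Type*} [MeasurableSpace Ω] (μ : Measure Ω) (X : Ω → α)
    (x : α) : ℝ :=
  (μ (X ⁻¹' {x})).toReal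

/-- The (random) conditional pmf `ω ↦ ℙ(Y = y | H = H ω)`. -/
noncomputable def condPMF {Ω α β : Type*} [MeasurableSpace Ω] (μ : Measure Ω)
    (Y : Ω → α) (H : Ω → β) (y : α) (ω : Ω) : ℝ :=
  (μ (Y ⁻¹' {y} ∩ H ⁻¹' {H ω})).toReal / (μ (H ⁻¹' {H ω})).toReal

/-- Kullback–Leibler divergence between two pmfs on a finite type (in nats). -/
noncomputable def klDiv' {α : Type*} [Fintype α] (p q : α → ℝ) : ℝ :=
  ∑ y, p y * Real.log (p y / q y)

/-- Shannon entropy (in nats) of a finite-valued random variable. -/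
noncomputable def entropy' {Ω α : Type*} [MeasurableSpace Ω] [Fintype α]
    (μ : Measure Ω) (X : Ω → α) : ℝ :=
  ∑ x, Real.negMulLog (pmfOf μ X x)

/-- Shannon mutual information (in nats) between two finite-valued random variables. -/
noncomputable def mi' {Ω α β : Type*} [MeasurableSpace Ω] [Fintype α] [Fintype β]
    (μ : Measure Ω) (X : Ω → α) (Y : Ω → β) : ℝ :=
  entropy' μ X + entropy' μ Y - entropy' μ (fun ω => (X ω, Y ω))

/-- Shannon conditional mutual information `I(X; Y | Z)` (in nats). -/
noncomputable def cmi' {Ω α β γ : Type*} [MeasurableSpace Ω] [Fintype α] [Fintype β] [Fintype γ]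
    (μ : Measure Ω) (X : Ω → α) (Y : Ω → β) (Z : Ω → γ) : ℝ :=
  entropy' μ (fun ω => (X ω, Z ω)) + entropy' μ (fun ω => (Y ω, Z ω))
    - entropy' μ (fun ω => (X ω, Y ω, Z ω)) - entropy' μ Z

section FiniteInformation

variable {Ω α β γ : Type*} [MeasurableSpace Ω] {μ : Measure Ω}

lemma pmfOf_nonneg (X : Ω → α) (x : α) : 0 ≤ pmfOf μ X x :=
  ENNReal.toReal_nonneg

lemma pmfOf_prodMk (X : Ω → α) (Z : Ω → β) (x : α) (z : β) :
    pmfOf μ (fun ω => (X ω, Z ω)) (x, z) = (μ (X ⁻¹' {x} ∩ Z ⁻¹' {z})).toReal := by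
  unfold pmfOf
  congr 2
  ext ω
  simp

lemma condPMF_eq_div (X : Ω → α) (Z : Ω → β) (x : α) (ω : Ω) :
    condPMF μ X Z x ω
      = pmfOf μ (fun ω => (X ω, Z ω)) (x, Z ω) / pmfOf μ Z (Z ω) := by
  rw [pmfOf_prodMk]
  rfl

lemma pmfOf_prodMk_le_left [IsFiniteMeasure μ] (X : Ω → α) (Z : Ω → β) (x : α) (z : β) :
    pmfOf μ (fun ω => (X ω, Z ω)) (x, z) ≤ pmfOf μ X x := by
  rw [pmfOf_prodMk]
  exact measureReal_mono Set.inter_subset_left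

lemma pmfOf_prodMk_le_right [IsFiniteMeasure μ] (X : Ω → α) (Z : Ω → β) (x : α) (z : β) :
    pmfOf μ (fun ω => (X ω, Z ω)) (x, z) ≤ pmfOf μ Z z := by
  rw [pmfOf_prodMk]
  exact measureReal_mono Set.inter_subset_right

lemma sum_measureReal_inter_preimage_singleton [IsFiniteMeasure μ] [Fintype β]
    [MeasurableSpace β] [MeasurableSingletonClass β] (s : Set Ω) {Z : Ω → β}
    (hZ : Measurable Z) :
    ∑ z, (μ (s ∩ Z ⁻¹' {z})).toReal = (μ s).toReal := by
  have key := sum_measure_preimage_singleton (μ := μ.restrict s) (f := Z) Finset.univ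
    (fun z _ => hZ (measurableSet_singleton z))
  simp only [Finset.coe_univ, Set.preimage_univ, Measure.restrict_apply_univ] at key
  rw [← key, ENNReal.toReal_sum (fun _ _ => measure_ne_top _ _)]
  refine Finset.sum_congr rfl fun z _ => ?_
  rw [Measure.restrict_apply (hZ (measurableSet_singleton z)), Set.inter_comm]

lemma sum_pmfOf_prodMk_right [IsFiniteMeasure μ] [Fintype β] [MeasurableSpace β]
    [MeasurableSingletonClass β] (X : Ω → α) {Z : Ω → β} (hZ : Measurable Z) (x : α) :
    ∑ z, pmfOf μ (fun ω => (X ω, Z ω)) (x, z) = pmfOf μ X x := by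
  simp only [pmfOf_prodMk]
  exact sum_measureReal_inter_preimage_singleton _ hZ

lemma sum_pmfOf_prodMk_left [IsFiniteMeasure μ] [Fintype α] [MeasurableSpace α]
    [MeasurableSingletonClass α] {X : Ω → α} (hX : Measurable X) (Z : Ω → β) (z : β) :
    ∑ x, pmfOf μ (fun ω => (X ω, Z ω)) (x, z) = pmfOf μ Z z := by
  simp only [pmfOf_prodMk, Set.inter_comm (X ⁻¹' _)]
  exact sum_measureReal_inter_preimage_singleton _ hX

lemma integral_comp_eq_sum_pmfOf [IsFiniteMeasure μ] [Fintype α] [MeasurableSpace α]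
    [MeasurableSingletonClass α] {X : Ω → α} (hX : Measurable X) (f : α → ℝ) :
    ∫ ω, f (X ω) ∂μ = ∑ x, pmfOf μ X x * f x := by
  have hf : Measurable f := measurable_of_finite f
  rw [← integral_map hX.aemeasurable hf.aestronglyMeasurable,
    integral_fintype .of_finite]
  refine Finset.sum_congr rfl fun x _ => ?_
  rw [smul_eq_mul, measureReal_def, Measure.map_apply hX (measurableSet_singleton x)]
  rfl

lemma entropy'_eq_sum_left [IsFiniteMeasure μ] [Fintype α] [Fintype β] [MeasurableSpace β]
    [MeasurableSingletonClass β] (X : Ω → α) {Z : Ω → β} (hZ : Measurable Z) :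
    entropy' μ X
      = -∑ x, ∑ z, pmfOf μ (fun ω => (X ω, Z ω)) (x, z) * Real.log (pmfOf μ X x) := by
  simp only [entropy', Real.negMulLog, ← Finset.sum_mul, sum_pmfOf_prodMk_right X hZ,
    ← Finset.sum_neg_distrib, neg_mul]

lemma entropy'_eq_sum_right [IsFiniteMeasure μ] [Fintype α] [Fintype β] [MeasurableSpace α]
    [MeasurableSingletonClass α] {X : Ω → α} (hX : Measurable X) (Z : Ω → β) :
    entropy' μ Z
      = -∑ x, ∑ z, pmfOf μ (fun ω => (X ω, Z ω)) (x, z) * Real.log (pmfOf μ Z z) := by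
  rw [Finset.sum_comm]
  simp only [entropy', Real.negMulLog, ← Finset.sum_mul, sum_pmfOf_prodMk_left hX Z,
    ← Finset.sum_neg_distrib, neg_mul]

lemma entropy'_prodMk [Fintype α] [Fintype β] (X : Ω → α) (Z : Ω → β) :
    entropy' μ (fun ω => (X ω, Z ω))
      = -∑ x, ∑ z, pmfOf μ (fun ω => (X ω, Z ω)) (x, z)
          * Real.log (pmfOf μ (fun ω => (X ω, Z ω)) (x, z)) := by
  simp only [entropy', Real.negMulLog, Fintype.sum_prod_type, ← Finset.sum_neg_distrib, neg_mul]

lemma entropy'_le_entropy'_prodMk [IsFiniteMeasure μ] [Fintype α] [Fintype β]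
    [MeasurableSpace β] [MeasurableSingletonClass β] (X : Ω → α) {Z : Ω → β}
    (hZ : Measurable Z) :
    entropy' μ X ≤ entropy' μ (fun ω => (X ω, Z ω)) := by
  rw [entropy'_eq_sum_left X hZ, entropy'_prodMk, neg_le_neg_iff]
  refine Finset.sum_le_sum fun x _ => Finset.sum_le_sum fun z _ => ?_
  rcases (pmfOf_nonneg (μ := μ) (fun ω => (X ω, Z ω)) (x, z)).eq_or_lt with h | h
  · simp [← h]
  · gcongr
    exact pmfOf_prodMk_le_left X Z x z

lemma mi'_eq_sum [IsFiniteMeasure μ] [Fintype α] [Fintype β]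
    [MeasurableSpace α] [MeasurableSingletonClass α]
    [MeasurableSpace β] [MeasurableSingletonClass β]
    {X : Ω → α} {Z : Ω → β} (hX : Measurable X) (hZ : Measurable Z) :
    mi' μ X Z = ∑ x, ∑ z, pmfOf μ (fun ω => (X ω, Z ω)) (x, z)
      * (Real.log (pmfOf μ (fun ω => (X ω, Z ω)) (x, z))
        - Real.log (pmfOf μ X x) - Real.log (pmfOf μ Z z)) := by
  rw [mi', entropy'_eq_sum_left X hZ, entropy'_eq_sum_right hX Z, entropy'_prodMk]
  simp only [mul_sub, Finset.sum_sub_distrib]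
  ring

/-- Under conditional independence of `X` and `Z` given `W`, weighting the difference of two
conditional divergence terms by `ℙ(W = w, Z = z)` yields a term weighted by the joint pmf. -/
lemma pmfOf_mul_sub_log_of_condIndep [IsFiniteMeasure μ]
    {X : Ω → α} {Z : Ω → β} {W : Ω → γ} (x : α) (z : β) (w : γ)
    (hCI : (μ (X ⁻¹' {x} ∩ Z ⁻¹' {z} ∩ W ⁻¹' {w})).toReal * (μ (W ⁻¹' {w})).toReal
      = (μ (X ⁻¹' {x} ∩ W ⁻¹' {w})).toReal * (μ (Z ⁻¹' {z} ∩ W ⁻¹' {w})).toReal) :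
    (μ (Z ⁻¹' {z} ∩ W ⁻¹' {w})).toReal
        * (pmfOf μ (fun ω => (X ω, W ω)) (x, w) / pmfOf μ W w
            * Real.log (pmfOf μ (fun ω => (X ω, W ω)) (x, w) / pmfOf μ W w / pmfOf μ X x)
          - pmfOf μ (fun ω => (X ω, W ω)) (x, w) / pmfOf μ W w
            * Real.log (pmfOf μ (fun ω => (X ω, W ω)) (x, w) / pmfOf μ W w
              / (pmfOf μ (fun ω => (X ω, Z ω)) (x, z) / pmfOf μ Z z)))
      = (μ (X ⁻¹' {x} ∩ Z ⁻¹' {z} ∩ W ⁻¹' {w})).toReal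
        * (Real.log (pmfOf μ (fun ω => (X ω, Z ω)) (x, z))
          - Real.log (pmfOf μ X x) - Real.log (pmfOf μ Z z)) := by
  have hXZ : (μ (X ⁻¹' {x} ∩ Z ⁻¹' {z} ∩ W ⁻¹' {w})).toReal
      ≤ pmfOf μ (fun ω => (X ω, Z ω)) (x, z) := by
    rw [pmfOf_prodMk]
    exact measureReal_mono Set.inter_subset_left
  have hXW : (μ (X ⁻¹' {x} ∩ Z ⁻¹' {z} ∩ W ⁻¹' {w})).toReal
      ≤ pmfOf μ (fun ω => (X ω, W ω)) (x, w) := by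
    rw [pmfOf_prodMk]
    exact measureReal_mono (Set.inter_subset_inter_left _ Set.inter_subset_left)
  have hX := pmfOf_prodMk_le_left (μ := μ) X Z x z
  have hZ := pmfOf_prodMk_le_right (μ := μ) X Z x z
  have hW := pmfOf_prodMk_le_right (μ := μ) X W x w
  have hW0 := pmfOf_nonneg (μ := μ) W w
  have hZW : (μ (Z ⁻¹' {z} ∩ W ⁻¹' {w})).toReal ≤ pmfOf μ W w :=
    measureReal_mono Set.inter_subset_right
  have hZW0 : 0 ≤ (μ (Z ⁻¹' {z} ∩ W ⁻¹' {w})).toReal := ENNReal.toReal_nonneg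
  have hj0 : 0 ≤ (μ (X ⁻¹' {x} ∩ Z ⁻¹' {z} ∩ W ⁻¹' {w})).toReal := ENNReal.toReal_nonneg
  rw [← pmfOf_prodMk X W] at hCI
  change _ * pmfOf μ W w = _ at hCI
  generalize (μ (X ⁻¹' {x} ∩ Z ⁻¹' {z} ∩ W ⁻¹' {w})).toReal = j at *
  generalize (μ (Z ⁻¹' {z} ∩ W ⁻¹' {w})).toReal = b at *
  generalize pmfOf μ (fun ω => (X ω, W ω)) (x, w) = a at *
  generalize pmfOf μ (fun ω => (X ω, Z ω)) (x, z) = d at *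
  generalize pmfOf μ W w = c at *
  generalize pmfOf μ X x = p at *
  generalize pmfOf μ Z z = q at *
  have hj : b * (a / c) = j := by
    rcases hW0.eq_or_lt with hc | hc
    · have hb : b = 0 := by linarith
      have : j = 0 := by linarith
      simp [hb, this]
    · field_simp
      linarith
  rw [← mul_sub, ← mul_assoc, hj]
  rcases hj0.eq_or_lt with h | h
  · simp [← h]
  · have hd : 0 < d := by linarith
    have ha : 0 < a := by linarith
    have hc : 0 < c := by linarith
    have hp : 0 < p := by linarith
    have hq : 0 < q := by linarith
    rw [Real.log_div (div_pos ha hc).ne' hp.ne',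
      Real.log_div (div_pos ha hc).ne' (div_pos hd hq).ne', Real.log_div hd.ne' hq.ne']
    ring

end FiniteInformation

/-- Suppose `Y` and `U` are conditionally independent given `H`. Then the reduction in
informational error relative to an uninformed prediction equals the mutual information between
`Y` and the agent state, which is bounded by the entropy of the agent state:
`E[d_KL(P*‖P₀)] − E[d_KL(P*‖P̃)] = I(Y; U)` and `I(Y; U) ≤ H(U)`. -/
theorem useful_information_capacity_bound
    {Ω 𝒴 ℋ 𝒰 : Type*} [MeasurableSpace Ω]
    [Fintype 𝒴] [Nonempty 𝒴] [MeasurableSpace 𝒴] [MeasurableSingletonClass 𝒴]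
    [Fintype ℋ] [Nonempty ℋ] [MeasurableSpace ℋ] [MeasurableSingletonClass ℋ]
    [Fintype 𝒰] [Nonempty 𝒰] [MeasurableSpace 𝒰] [MeasurableSingletonClass 𝒰]
    (μ : Measure Ω) [IsProbabilityMeasure μ]
    (Y : Ω → 𝒴) (H : Ω → ℋ) (U : Ω → 𝒰)
    (hY : Measurable Y) (hH : Measurable H) (hU : Measurable U)
    (hCI : ∀ (y : 𝒴) (u : 𝒰) (h : ℋ),
      (μ (Y ⁻¹' {y} ∩ U ⁻¹' {u} ∩ H ⁻¹' {h})).toReal * (μ (H ⁻¹' {h})).toReal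
        = (μ (Y ⁻¹' {y} ∩ H ⁻¹' {h})).toReal * (μ (U ⁻¹' {u} ∩ H ⁻¹' {h})).toReal) :
    (∫ ω, klDiv' (fun y => condPMF μ Y H y ω) (fun y => pmfOf μ Y y) ∂μ
        - ∫ ω, klDiv' (fun y => condPMF μ Y H y ω) (fun y => condPMF μ Y U y ω) ∂μ
      = mi' μ Y U)
    ∧ mi' μ Y U ≤ entropy' μ U := by
  refine ⟨?_, ?_⟩
  · simp only [klDiv', condPMF_eq_div]
    have hZW : Measurable fun ω => (U ω, H ω) := hU.prodMk hH
    rw [integral_comp_eq_sum_pmfOf hZW (fun p => ∑ y,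
        pmfOf μ (fun ω => (Y ω, H ω)) (y, p.2) / pmfOf μ H p.2
          * Real.log (pmfOf μ (fun ω => (Y ω, H ω)) (y, p.2) / pmfOf μ H p.2 / pmfOf μ Y y)),
      integral_comp_eq_sum_pmfOf hZW (fun p => ∑ y,
        pmfOf μ (fun ω => (Y ω, H ω)) (y, p.2) / pmfOf μ H p.2
          * Real.log (pmfOf μ (fun ω => (Y ω, H ω)) (y, p.2) / pmfOf μ H p.2
            / (pmfOf μ (fun ω => (Y ω, U ω)) (y, p.1) / pmfOf μ U p.1))),
      mi'_eq_sum hY hU]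
    simp only [← Finset.sum_sub_distrib, ← mul_sub, Fintype.sum_prod_type, Finset.mul_sum]
    simp only [mul_sub (_ / _), pmfOf_prodMk U H,
      fun y u h => pmfOf_mul_sub_log_of_condIndep y u h (hCI y u h)]
    rw [Finset.sum_congr rfl fun u _ => Finset.sum_comm, Finset.sum_comm]
    simp only [← Finset.sum_mul, sum_measureReal_inter_preimage_singleton _ hH,
      pmfOf_prodMk Y U]
  · have := entropy'_le_entropy'_prodMk (μ := μ) Y hU
    rw [mi']
    linarith
end

section
/- For every fixed integer t ≥ 0, the cumulative implasticity error over lags equals a single conditional mutual information with the future: Σ_{k=0}^{t} I(Y_{t+k+1}; O_t | U_t, H_{t+1:t+k}) = I(H_{t+1:2t+1}; O_t | U_t), where the k = 0 summand is I(Y_{t+1}; O_t | U_t). -/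
open MeasureTheory

section EntropyLemmas

variable {Ω α β : Type*} [MeasurableSpace Ω] {μ : Measure Ω}

lemma entropy'_equiv_comp [Fintype α] [Fintype β] (e : α ≃ β) (X : Ω → α) :
    entropy' μ (fun ω => e (X ω)) = entropy' μ X := by
  unfold entropy'
  rw [← e.sum_comp]
  refine Finset.sum_congr rfl fun x _ => ?_
  congr 2
  unfold pmfOf
  congr 2
  ext ω
  simp

lemma sum_pmfOf_eq_one [Fintype α] [MeasurableSpace α] [MeasurableSingletonClass α]
    [IsProbabilityMeasure μ] {X : Ω → α} (hX : Measurable X) : ∑ x, pmfOf μ X x = 1 := by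
  have h := sum_measureReal_preimage_singleton (μ := μ) (f := X) Finset.univ
    fun y _ => hX (measurableSet_singleton y)
  simpa [pmfOf, Measure.real] using h

lemma entropy'_prodMk_of_indepFun [Fintype α] [MeasurableSpace α] [MeasurableSingletonClass α]
    [Fintype β] [MeasurableSpace β] [MeasurableSingletonClass β] [IsProbabilityMeasure μ]
    {X : Ω → α} {W : Ω → β} (hX : Measurable X) (hW : Measurable W)
    (h : ProbabilityTheory.IndepFun X W μ) :
    entropy' μ (fun ω => (X ω, W ω)) = entropy' μ X + entropy' μ W := by
  have hp (x : α) (w : β) :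
      pmfOf μ (fun ω => (X ω, W ω)) (x, w) = pmfOf μ X x * pmfOf μ W w := by
    have hxw := h.measure_inter_preimage_eq_mul {x} {w} (measurableSet_singleton x)
      (measurableSet_singleton w)
    simp only [pmfOf, ← ENNReal.toReal_mul, ← hxw]
    congr 2
    ext ω
    simp
  simp only [entropy', Fintype.sum_prod_type, hp, Real.negMulLog_mul, Finset.sum_add_distrib,
    ← Finset.mul_sum, ← Finset.sum_mul, sum_pmfOf_eq_one hX, sum_pmfOf_eq_one hW, one_mul]

lemma indepFun_of_measure_singleton [Countable α] [MeasurableSpace α] [MeasurableSingletonClass α]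
    [Countable β] [MeasurableSpace β] [MeasurableSingletonClass β] [IsProbabilityMeasure μ]
    {X : Ω → α} {W : Ω → β} (hX : Measurable X) (hW : Measurable W)
    (h : ∀ x w, μ {ω | X ω = x ∧ W ω = w} = μ {ω | X ω = x} * μ {ω | W ω = w}) :
    ProbabilityTheory.IndepFun X W μ := by
  rw [ProbabilityTheory.indepFun_iff_map_prod_eq_prod_map_map hX.aemeasurable hW.aemeasurable]
  refine Measure.ext_of_singleton fun ⟨x, w⟩ => ?_
  rw [← Set.singleton_prod_singleton, Measure.prod_prod,
    Measure.map_apply (hX.prodMk hW)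
      ((measurableSet_singleton x).prod (measurableSet_singleton w)),
    Measure.map_apply hX (measurableSet_singleton x),
    Measure.map_apply hW (measurableSet_singleton w)]
  exact h x w

end EntropyLemmas

/-- Appending the pair `(y, x)` to a tuple of pairs, alongside a spectator coordinate, as an
equivalence. -/
def snocPairEquiv (𝒳 𝒴 γ : Type*) (k : ℕ) :
    𝒳 × (𝒴 × (γ × (Fin k → 𝒴 × 𝒳))) ≃ (Fin (k + 1) → 𝒴 × 𝒳) × γ where
  toFun p := (Fin.snoc (α := fun _ => 𝒴 × 𝒳) p.2.2.2 (p.2.1, p.1), p.2.2.1)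
  invFun q := ((q.1 (Fin.last k)).2, (q.1 (Fin.last k)).1, q.2, fun i => q.1 i.castSucc)
  left_inv p := by simp
  right_inv q := by
    refine Prod.ext ?_ rfl
    exact Fin.snoc_init_self q.1

/-- Appending `(Y, X)` to a tuple, with `X` independent of all the rest, adds the entropy of `X`. -/
lemma entropy'_snoc_of_indepFun {Ω 𝒳 𝒴 γ : Type*} [MeasurableSpace Ω]
    [Fintype 𝒳] [MeasurableSpace 𝒳] [MeasurableSingletonClass 𝒳]
    [Fintype 𝒴] [MeasurableSpace 𝒴] [MeasurableSingletonClass 𝒴]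
    [Fintype γ] [MeasurableSpace γ] [MeasurableSingletonClass γ]
    {μ : Measure Ω} [IsProbabilityMeasure μ] {k : ℕ}
    {X : Ω → 𝒳} {Y : Ω → 𝒴} {Z : Ω → γ} {T : Ω → Fin k → 𝒴 × 𝒳}
    (hX : Measurable X) (hY : Measurable Y) (hZ : Measurable Z) (hT : Measurable T)
    (h : ProbabilityTheory.IndepFun X (fun ω => (Y ω, Z ω, T ω)) μ) :
    entropy' μ (fun ω => (Fin.snoc (α := fun _ => 𝒴 × 𝒳) (T ω) (Y ω, X ω), Z ω)) =
      entropy' μ X + entropy' μ (fun ω => (Y ω, Z ω, T ω)) := by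
  rw [← entropy'_prodMk_of_indepFun hX (hY.prodMk (hZ.prodMk hT)) h,
    ← entropy'_equiv_comp (snocPairEquiv 𝒳 𝒴 γ k)]
  rfl

/-- If the input at time `s + 1` is independent of the past in the sense of a product formula for
point masses, then it is independent of the past tuple as a random variable. -/
lemma indepFun_past {Ω 𝒳 𝒴 𝒰 : Type*} [MeasurableSpace Ω]
    [Fintype 𝒳] [MeasurableSpace 𝒳] [MeasurableSingletonClass 𝒳]
    [Fintype 𝒴] [MeasurableSpace 𝒴] [MeasurableSingletonClass 𝒴]
    [Fintype 𝒰] [MeasurableSpace 𝒰] [MeasurableSingletonClass 𝒰]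
    {μ : Measure Ω} [IsProbabilityMeasure μ]
    {X : ℕ → Ω → 𝒳} {Y : ℕ → Ω → 𝒴} {U : ℕ → Ω → 𝒰}
    (hX : ∀ i, Measurable (X i)) (hY : ∀ i, Measurable (Y i)) (hU : ∀ i, Measurable (U i)) (s : ℕ)
    (h : ∀ (x : 𝒳) (u : ℕ → 𝒰) (o : ℕ → 𝒴 × 𝒳) (y : 𝒴),
      μ {ω | X (s + 1) ω = x ∧ ((∀ i ≤ s, U i ω = u i)
              ∧ (∀ i ≤ s, (Y i ω, X i ω) = o i) ∧ Y (s + 1) ω = y)}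
        = μ {ω | X (s + 1) ω = x}
            * μ {ω | (∀ i ≤ s, U i ω = u i)
                  ∧ (∀ i ≤ s, (Y i ω, X i ω) = o i) ∧ Y (s + 1) ω = y}) :
    ProbabilityTheory.IndepFun (X (s + 1))
      (fun ω => ((fun i : Fin (s + 1) => U i ω), (fun i : Fin (s + 1) => (Y i ω, X i ω)),
        Y (s + 1) ω)) μ := by
  refine indepFun_of_measure_singleton (hX _) (by fun_prop) fun x ⟨a, b, y⟩ => ?_
  have hall (P : ℕ → Fin (s + 1) → Prop) :
      (∀ i : Fin (s + 1), P i i) ↔ ∀ i ≤ s, P i (Fin.ofNat (s + 1) i) := by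
    refine ⟨fun h i hi => ?_, fun h i => ?_⟩
    · simpa [Nat.mod_eq_of_lt (Nat.lt_succ_of_le hi)] using h (Fin.ofNat (s + 1) i)
    · simpa using h i (Nat.le_of_lt_succ i.2)
  have hset (ω : Ω) :
      ((fun i : Fin (s + 1) => U i ω), (fun i : Fin (s + 1) => (Y i ω, X i ω)),
        Y (s + 1) ω) = (a, b, y) ↔
      (∀ i ≤ s, U i ω = a (Fin.ofNat (s + 1) i)) ∧
        (∀ i ≤ s, (Y i ω, X i ω) = b (Fin.ofNat (s + 1) i)) ∧ Y (s + 1) ω = y := by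
    rw [← hall fun i j => U i ω = a j, ← hall fun i j => (Y i ω, X i ω) = b j,
      Prod.mk.injEq, Prod.mk.injEq, funext_iff, funext_iff]
  simp only [hset]
  exact h x _ _ y

/-- For every fixed integer `t ≥ 0`, assuming each input `X_{s+1}` is independent of
`(U_0, …, U_s, O_0, …, O_s, Y_{s+1})` (where `O_i = (Y_i, X_i)`), the cumulative implasticity
error over lags equals a single conditional mutual information with the future:
`Σ_{k=0}^{t} I(Y_{t+k+1}; O_t | U_t, H_{t+1:t+k}) = I(H_{t+1:2t+1}; O_t | U_t)`,
where the `k = 0` summand is `I(Y_{t+1}; O_t | U_t)`. -/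
theorem cumulative_implasticity_error
    {Ω 𝒳 𝒴 𝒰 : Type*} [MeasurableSpace Ω]
    [Fintype 𝒳] [Nonempty 𝒳] [MeasurableSpace 𝒳] [MeasurableSingletonClass 𝒳]
    [Fintype 𝒴] [Nonempty 𝒴] [MeasurableSpace 𝒴] [MeasurableSingletonClass 𝒴]
    [Fintype 𝒰] [Nonempty 𝒰] [MeasurableSpace 𝒰] [MeasurableSingletonClass 𝒰]
    (μ : Measure Ω) [IsProbabilityMeasure μ]
    (t : ℕ)
    (X : ℕ → Ω → 𝒳) (Y : ℕ → Ω → 𝒴) (U : ℕ → Ω → 𝒰)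
    (hXm : ∀ i, Measurable (X i)) (hYm : ∀ i, Measurable (Y i)) (hUm : ∀ i, Measurable (U i))
    (hindep : ∀ (s : ℕ) (x : 𝒳) (u : ℕ → 𝒰) (o : ℕ → 𝒴 × 𝒳) (y : 𝒴),
      μ {ω | X (s + 1) ω = x ∧ ((∀ i ≤ s, U i ω = u i)
              ∧ (∀ i ≤ s, (Y i ω, X i ω) = o i) ∧ Y (s + 1) ω = y)}
        = μ {ω | X (s + 1) ω = x}
            * μ {ω | (∀ i ≤ s, U i ω = u i)
                  ∧ (∀ i ≤ s, (Y i ω, X i ω) = o i) ∧ Y (s + 1) ω = y}) :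
    ∑ k ∈ Finset.range (t + 1),
        cmi' μ (Y (t + k + 1)) (fun ω => (Y t ω, X t ω))
          (fun ω => (U t ω, fun i : Fin k => (Y (t + 1 + (i : ℕ)) ω, X (t + 1 + (i : ℕ)) ω)))
      = cmi' μ (fun ω => fun i : Fin (t + 1) => (Y (t + 1 + (i : ℕ)) ω, X (t + 1 + (i : ℕ)) ω))
          (fun ω => (Y t ω, X t ω)) (U t) := by
  let F (k : ℕ) (ω : Ω) (i : Fin k) : 𝒴 × 𝒳 := (Y (t + 1 + (i : ℕ)) ω, X (t + 1 + (i : ℕ)) ω)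
  let O (ω : Ω) : 𝒴 × 𝒳 := (Y t ω, X t ω)
  have hOm : Measurable O := by fun_prop
  have hF (k : ℕ) : Measurable (F k) := by fun_prop
  have hsucc (k : ℕ) (ω : Ω) : F (k + 1) ω =
      Fin.snoc (α := fun _ => 𝒴 × 𝒳) (F k ω) (Y (t + k + 1) ω, X (t + k + 1) ω) := by
    refine funext (Fin.lastCases ?_ fun j => ?_)
    · simp [F, add_right_comm]
    · simp [F]
  have hind (k : ℕ) : ProbabilityTheory.IndepFun (X (t + k + 1))
      (fun ω => (Y (t + k + 1) ω, (O ω, U t ω), F k ω)) μ := by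
    let φ (p : (Fin (t + k + 1) → 𝒰) × (Fin (t + k + 1) → 𝒴 × 𝒳) × 𝒴) :
        𝒴 × ((𝒴 × 𝒳) × 𝒰) × (Fin k → 𝒴 × 𝒳) :=
      (p.2.2, (p.2.1 ⟨t, by omega⟩, p.1 ⟨t, by omega⟩),
        fun i => p.2.1 ⟨t + 1 + i, by omega⟩)
    exact (indepFun_past hXm hYm hUm (t + k) (hindep (t + k))).comp measurable_id
      (measurable_of_countable φ)
  have hYOUF (k : ℕ) : entropy' μ (fun ω => (F (k + 1) ω, O ω, U t ω)) =
      entropy' μ (X (t + k + 1)) +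
        entropy' μ (fun ω => (Y (t + k + 1) ω, (O ω, U t ω), F k ω)) := by
    simp only [hsucc]
    exact entropy'_snoc_of_indepFun (hXm _) (hYm _) (hOm.prodMk (hUm t)) (hF k) (hind k)
  have hYUF (k : ℕ) : entropy' μ (fun ω => (F (k + 1) ω, U t ω)) =
      entropy' μ (X (t + k + 1)) + entropy' μ (fun ω => (Y (t + k + 1) ω, U t ω, F k ω)) := by
    simp only [hsucc]
    let ψ (p : 𝒴 × ((𝒴 × 𝒳) × 𝒰) × (Fin k → 𝒴 × 𝒳)) : 𝒴 × 𝒰 × (Fin k → 𝒴 × 𝒳) :=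
      (p.1, p.2.1.2, p.2.2)
    exact entropy'_snoc_of_indepFun (hXm _) (hYm _) (hUm t) (hF k)
      ((hind k).comp measurable_id (measurable_of_countable ψ))
  have hU (k : ℕ) : entropy' μ (fun ω => (U t ω, F k ω)) =
      entropy' μ (fun ω => (F k ω, U t ω)) :=
    entropy'_equiv_comp (Equiv.prodComm _ _) (fun ω => (F k ω, U t ω))
  have hOU (k : ℕ) : entropy' μ (fun ω => (O ω, U t ω, F k ω)) =
      entropy' μ (fun ω => (F k ω, O ω, U t ω)) :=
    entropy'_equiv_comp ((Equiv.prodComm _ _).trans (Equiv.prodAssoc _ _ _))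
      (fun ω => (F k ω, O ω, U t ω))
  have hYOU (k : ℕ) : entropy' μ (fun ω => (Y (t + k + 1) ω, O ω, U t ω, F k ω)) =
      entropy' μ (fun ω => (Y (t + k + 1) ω, (O ω, U t ω), F k ω)) :=
    entropy'_equiv_comp ((Equiv.refl 𝒴).prodCongr (Equiv.prodAssoc _ _ _))
      (fun ω => (Y (t + k + 1) ω, (O ω, U t ω), F k ω))
  have hU0 : entropy' μ (fun ω => (F 0 ω, U t ω)) = entropy' μ (U t) :=
    (entropy'_equiv_comp (Equiv.uniqueProd 𝒰 (Fin 0 → 𝒴 × 𝒳)) (fun ω => (F 0 ω, U t ω))).symm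
  have hOU0 : entropy' μ (fun ω => (F 0 ω, O ω, U t ω)) =
      entropy' μ (fun ω => (O ω, U t ω)) :=
    (entropy'_equiv_comp (Equiv.uniqueProd ((𝒴 × 𝒳) × 𝒰) (Fin 0 → 𝒴 × 𝒳))
      (fun ω => (F 0 ω, O ω, U t ω))).symm
  let D (k : ℕ) : ℝ :=
    entropy' μ (fun ω => (F k ω, U t ω)) - entropy' μ (fun ω => (F k ω, O ω, U t ω))
  have hterm (k : ℕ) :
      cmi' μ (Y (t + k + 1)) O (fun ω => (U t ω, F k ω)) = D (k + 1) - D k := by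
    simp only [cmi', D, hU, hOU, hYOU, hYUF, hYOUF]
    ring
  calc ∑ k ∈ Finset.range (t + 1), cmi' μ (Y (t + k + 1)) O (fun ω => (U t ω, F k ω))
      = D (t + 1) - D 0 := by simp only [hterm, Finset.sum_range_sub]
    _ = cmi' μ (F (t + 1)) O (U t) := by
      simp only [cmi', D, hU0, hOU0]
      ring
end
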